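/- Let K be a field and let (A, d) be a finite-dimensional dg K-algebra such that A is a split simple K-algebra, i.e., A is isomorphic as a K-algebra to a full matrix algebra Mat_n(K). Then there exists a bounded complex L of finite-dimensional K-vector spaces such that A ≅ End•_K(L)^op as dg K-algebras. -/

import Mathlib

open scoped TensorProduct DirectSum

/-- The predicate that `(𝒞, dC)` is a (cochain) complex structure on the `ℤ`-graded
`K`-module `C`: the differential has degree `+1` and squares to zero. -/
structure IsComplex {K C : Type} [Field K] [AddCommGroup C] [Module K C]
    (𝒞 : ℤ → Submodule K C) (dC : C →ₗ[K] C) : Prop where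
  map_mem : ∀ n : ℤ, ∀ x ∈ 𝒞 n, dC x ∈ 𝒞 (n + 1)
  sq : ∀ x : C, dC (dC x) = 0

/-- The predicate that `d` makes the `ℤ`-graded `K`-algebra `(A, 𝒜)` into a differential
graded `K`-algebra: `d` has degree `+1`, squares to zero, and satisfies the graded Leibniz
rule `d (a * b) = d a * b + (-1)^{|a|} • (a * d b)` on homogeneous elements. -/
structure IsDGAlgebra {K A : Type} [Field K] [Ring A] [Algebra K A]
    (𝒜 : ℤ → Submodule K A) (d : A →ₗ[K] A) : Prop where
  map_mem : ∀ n : ℤ, ∀ a ∈ 𝒜 n, d a ∈ 𝒜 (n + 1)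
  sq : ∀ a : A, d (d a) = 0
  leibniz : ∀ m n : ℤ, ∀ a ∈ 𝒜 m, ∀ b ∈ 𝒜 n,
    d (a * b) = d a * b + ((-1 : K) ^ m.natAbs) • (a * d b)

/-- The degree-`n` component of `End•_K(C)`: all `K`-linear endomorphisms of `C` that
shift degrees by `n`. -/
def endGrading (K : Type) {C : Type} [Field K] [AddCommGroup C] [Module K C]
    (𝒞 : ℤ → Submodule K C) (n : ℤ) : Submodule K (Module.End K C) where
  carrier := {f | ∀ k : ℤ, ∀ x ∈ 𝒞 k, f x ∈ 𝒞 (k + n)}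
  add_mem' := fun hf hg k x hx => add_mem (hf k x hx) (hg k x hx)
  zero_mem' := fun k x _ => by simp
  smul_mem' := fun c f hf k x hx => Submodule.smul_mem _ c (hf k x hx)

/-- The sign operator on a `ℤ`-graded module: multiplication by `(-1)^n` on the
degree-`n` component. -/
noncomputable def signOp (K : Type) {C : Type} [Field K] [AddCommGroup C] [Module K C]
    (𝒞 : ℤ → Submodule K C) [DirectSum.Decomposition 𝒞] : Module.End K C :=
  (DirectSum.toModule K ℤ C fun n => ((-1 : K) ^ n.natAbs) • (𝒞 n).subtype) ∘ₗ
    (DirectSum.decomposeLinearEquiv 𝒞).toLinearMap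

/-- The differential `d_Hom` on `End•_K(C)`, given on a homogeneous `f` of degree `|f|` by
`d_Hom f = d_C ∘ f - (-1)^{|f|} f ∘ d_C`; it is expressed via the sign operator
(`(-1)^{|f|} f = ε ∘ f ∘ ε` on homogeneous `f`) so as to be globally linear in `f`. -/
noncomputable def endDiff (K : Type) {C : Type} [Field K] [AddCommGroup C] [Module K C]
    (𝒞 : ℤ → Submodule K C) [DirectSum.Decomposition 𝒞] (dC : C →ₗ[K] C) :
    Module.End K C →ₗ[K] Module.End K C where
  toFun f := dC ∘ₗ f - signOp K 𝒞 ∘ₗ f ∘ₗ signOp K 𝒞 ∘ₗ dC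
  map_add' f g := by
    simp only [LinearMap.comp_add, LinearMap.add_comp]; abel
  map_smul' c f := by
    simp only [LinearMap.comp_smul, LinearMap.smul_comp, RingHom.id_apply, smul_sub]

/-- An isomorphism of differential graded `K`-algebras: an algebra isomorphism which is
degree-preserving and intertwines the differentials. -/
structure IsDGIso {K A B : Type} [Field K] [Ring A] [Algebra K A] [Ring B] [Algebra K B]
    (𝒜 : ℤ → Submodule K A) (ℬ : ℤ → Submodule K B)
    (dA : A →ₗ[K] A) (dB : B →ₗ[K] B) (e : A ≃ₐ[K] B) : Prop where
  map_grading : ∀ n : ℤ, (𝒜 n).map (e : A →ₗ[K] B) = ℬ n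
  map_diff : ∀ a : A, e (dA a) = dB (e a)

/-- A bounded complex of finite-dimensional `K`-vector spaces (boundedness is automatic
from finite-dimensionality), bundled with the graded-algebra structure on its
endomorphism algebra. -/
structure FinComplex (K : Type) [Field K] where
  carrier : Type
  [acg : AddCommGroup carrier]
  [mod : Module K carrier]
  [findim : FiniteDimensional K carrier]
  grading : ℤ → Submodule K carrier
  [decomp : DirectSum.Decomposition grading]
  diff : carrier →ₗ[K] carrier
  complex : IsComplex grading diff
  [endGraded : GradedAlgebra (endGrading K grading)]

attribute [instance] FinComplex.acg FinComplex.mod FinComplex.findim FinComplex.decomp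
  FinComplex.endGraded

section TensorDG

variable (K : Type) [Field K] {A B : Type} [Ring A] [Algebra K A] [Ring B] [Algebra K B]
  (𝒜 : ℤ → Submodule K A) (ℬ : ℤ → Submodule K B) [GradedAlgebra 𝒜] [GradedAlgebra ℬ]

/-- The degree-`n` component of the graded (Koszul-signed) tensor product `𝒜 ᵍ⊗[K] ℬ`:
the span of the `a ⊗ b` with `a, b` homogeneous and `|a| + |b| = n`. -/
noncomputable def gtGrading (n : ℤ) : Submodule K (𝒜 ᵍ⊗[K] ℬ) :=
  Submodule.span K {x | ∃ i j : ℤ, i + j = n ∧ ∃ a ∈ 𝒜 i, ∃ b ∈ ℬ j, x = a ᵍ⊗ₜ[K] b}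

/-- The differential of the tensor product of differential graded algebras:
`d (a ⊗ b) = dA a ⊗ b + (-1)^{|a|} a ⊗ dB b` for `a` homogeneous. -/
noncomputable def gtDiff (dA : A →ₗ[K] A) (dB : B →ₗ[K] B) :
    (𝒜 ᵍ⊗[K] ℬ) →ₗ[K] (𝒜 ᵍ⊗[K] ℬ) :=
  (GradedTensorProduct.of K 𝒜 ℬ).toLinearMap ∘ₗ
    (TensorProduct.map dA LinearMap.id + TensorProduct.map (signOp K 𝒜) dB) ∘ₗ
      (GradedTensorProduct.of K 𝒜 ℬ).symm.toLinearMap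

end TensorDG

/-- Two differential graded `K`-algebras `(A, 𝒜, dA)` and `(B, ℬ, dB)` are *equivalent*
if there are bounded complexes `C₁`, `C₂` of finite-dimensional `K`-vector spaces such
that `A ⊗_K End•_K(C₁) ≅ B ⊗_K End•_K(C₂)` as differential graded `K`-algebras. -/
noncomputable def DGEquivalent (K : Type) [Field K] {A B : Type}
    [Ring A] [Algebra K A] [Ring B] [Algebra K B]
    (𝒜 : ℤ → Submodule K A) (ℬ : ℤ → Submodule K B)
    (gA : GradedAlgebra 𝒜) (gB : GradedAlgebra ℬ)
    (dA : A →ₗ[K] A) (dB : B →ₗ[K] B) : Prop :=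
  ∃ C₁ C₂ : FinComplex K,
    ∃ e : (𝒜 ᵍ⊗[K] endGrading K C₁.grading) ≃ₐ[K] (ℬ ᵍ⊗[K] endGrading K C₂.grading),
      IsDGIso (gtGrading K 𝒜 (endGrading K C₁.grading))
        (gtGrading K ℬ (endGrading K C₂.grading))
        (gtDiff K 𝒜 (endGrading K C₁.grading) dA (endDiff K C₁.grading C₁.diff))
        (gtDiff K ℬ (endGrading K C₂.grading) dB (endDiff K C₂.grading C₂.diff)) e

section Homogeneous

variable {K A : Type*} [Field K] [Ring A] [Algebra K A]

theorem neg_one_pow_natAbs_eq_zpow (m : ℤ) : (-1 : K) ^ m.natAbs = (-1 : K) ^ m := by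
  obtain h | h := m.even_or_odd
  · rw [h.neg_one_zpow, (Int.natAbs_even.mpr h).neg_one_pow]
  · rw [h.neg_one_zpow, (Int.natAbs_odd.mpr h).neg_one_pow]

theorem neg_one_pow_natAbs_mul_natAbs (m n : ℤ) :
    (-1 : K) ^ (m.natAbs * n.natAbs) = (-1 : K) ^ (m * n) := by
  rw [← Int.natAbs_mul, neg_one_pow_natAbs_eq_zpow]

theorem Matrix.eq_zero_or_eq_zero_of_forall_mul_mul_eq_zero {n : Type*} [Fintype n] [DecidableEq n]
    {M N : Matrix n n K} (h : ∀ C, M * C * N = 0) : M = 0 ∨ N = 0 := by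
  by_contra! hMN
  obtain ⟨i, j, hij⟩ : ∃ i j, M i j ≠ 0 := by
    by_contra! h0
    exact hMN.1 (Matrix.ext h0)
  obtain ⟨k, l, hkl⟩ : ∃ k l, N k l ≠ 0 := by
    by_contra! h0
    exact hMN.2 (Matrix.ext h0)
  have h1 := congrFun (congrFun (h (Matrix.single j k 1)) i) l
  rw [Matrix.mul_assoc, Matrix.mul_apply, Finset.sum_eq_single j] at h1
  · simp [hij, hkl] at h1
  · intro b _ hb
    simp [hb]
  · simp

theorem Matrix.single_mul_mul_single_eq_smul {n : Type*} [Fintype n] [DecidableEq n] (i : n)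
    (M : Matrix n n K) :
    Matrix.single i i (1 : K) * M * Matrix.single i i 1 = M i i • Matrix.single i i (1 : K) := by
  simp

variable (𝒜 : ℤ → Submodule K A) [GradedAlgebra 𝒜]

/-- The product of two elements supported in degrees `≥ i` and `≥ j` is supported in degrees
`≥ i + j`, and its component of degree `i + j` is the product of the lowest components. -/
theorem coe_decompose_mul_of_bddBelow {x y : A} {i j : ℤ}
    (hx : ∀ k < i, (DirectSum.decompose 𝒜 x k : A) = 0)
    (hy : ∀ k < j, (DirectSum.decompose 𝒜 y k : A) = 0) (n : ℤ) (hn : n ≤ i + j) :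
    (DirectSum.decompose 𝒜 (x * y) n : A) =
      if n = i + j then (DirectSum.decompose 𝒜 x i : A) * DirectSum.decompose 𝒜 y j else 0 := by
  classical
  rw [DirectSum.decompose_mul, DirectSum.coe_mul_apply_eq_dfinsuppSum]
  have key : ∀ p q : ℤ, (if p + q = n then
      (DirectSum.decompose 𝒜 x p : A) * DirectSum.decompose 𝒜 y q else 0) =
      if p = i then (if q = j then (if n = i + j then
        (DirectSum.decompose 𝒜 x i : A) * DirectSum.decompose 𝒜 y j else 0) else 0) else 0 := by
    intro p q
    rcases lt_trichotomy p i with hp | rfl | hp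
    · simp [hx p hp, hp.ne]
    · rcases lt_trichotomy q j with hq | rfl | hq
      · simp [hy q hq, hq.ne]
      · simp [eq_comm]
      · rw [if_neg (by omega)]
        simp [hq.ne']
    · rw [if_neg hp.ne']
      by_cases hq : q < j
      · simp [hy q hq]
      · rw [if_neg (by omega)]
  simp only [DFinsupp.sum, key, Finset.sum_ite_eq', Finset.sum_ite_irrel, Finset.sum_const_zero]
  split_ifs <;> simp_all

/-- If `z A z ⊆ K z`, then the lowest homogeneous component `w` of `z` satisfies `w A w ⊆ K w`. -/
theorem exists_homogeneous_mul_mul_eq_smul {z : A} (hz : z ≠ 0)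
    (hzz : ∀ a, ∃ c : K, z * a * z = c • z) :
    ∃ k : ℤ, ∃ w ∈ 𝒜 k, w ≠ 0 ∧ ∀ a, ∃ c : K, w * a * w = c • w := by
  classical
  have hne : (DirectSum.decompose 𝒜 z).support.Nonempty := by
    rw [Finset.nonempty_iff_ne_empty]
    intro h
    rw [DFinsupp.support_eq_empty] at h
    exact hz ((DirectSum.decompose 𝒜).injective (by rw [h, DirectSum.decompose_zero]))
  set k := (DirectSum.decompose 𝒜 z).support.min' hne with hk
  have hzk : (DirectSum.decompose 𝒜 z k : A) ≠ 0 := by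
    have := Finset.min'_mem _ hne
    rw [DFinsupp.mem_support_toFun] at this
    simpa using this
  have hlow : ∀ i < k, (DirectSum.decompose 𝒜 z i : A) = 0 := by
    intro i hi
    by_contra h
    refine absurd (Finset.min'_le _ i ?_) (not_le.mpr hi)
    rw [DFinsupp.mem_support_toFun]
    simpa using h
  refine ⟨k, _, SetLike.coe_mem (DirectSum.decompose 𝒜 z k), hzk, fun a => ?_⟩
  set w : A := (DirectSum.decompose 𝒜 z k : A) with hw
  induction a using DirectSum.Decomposition.inductionOn 𝒜 with
  | zero => exact ⟨0, by simp⟩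
  | add a b ha hb =>
    obtain ⟨c, hc⟩ := ha
    obtain ⟨c', hc'⟩ := hb
    exact ⟨c + c', by rw [mul_add, add_mul, hc, hc', add_smul]⟩
  | @homogeneous j a =>
    have halow : ∀ i < j, (DirectSum.decompose 𝒜 (a : A) i : A) = 0 := fun i hi =>
      DirectSum.decompose_of_mem_ne 𝒜 a.2 hi.ne'
    have hza := coe_decompose_mul_of_bddBelow 𝒜 hlow halow
    have hzaz := coe_decompose_mul_of_bddBelow 𝒜 (x := z * a) (i := k + j)
      (fun i hi => by rw [hza i hi.le, if_neg hi.ne]) hlow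
    rw [hza _ le_rfl, if_pos rfl, DirectSum.decompose_of_mem_same 𝒜 a.2, ← hw] at hzaz
    obtain ⟨c, hc⟩ := hzz a
    simp only [hc, DirectSum.decompose_smul, DirectSum.smul_apply, Submodule.coe_smul] at hzaz
    have htop := hzaz _ le_rfl
    rw [if_pos rfl] at htop
    rcases lt_trichotomy (k + j + k) k with h | h | h
    · exact ⟨0, by rw [← htop, hlow _ h, smul_zero, zero_smul]⟩
    · exact ⟨c, by rw [← htop, h]⟩
    · have h0 := hzaz k h.le
      rw [if_neg h.ne, smul_eq_zero, or_iff_left hzk] at h0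
      exact ⟨0, by rw [← htop, h0, zero_smul, zero_smul]⟩

/-- A graded prime algebra containing `z ≠ 0` with `z A z ⊆ K z` contains an idempotent `e ≠ 0` of
degree zero with `e A e ⊆ K e`. -/
theorem exists_idempotent_degree_zero (hprime : ∀ a b : A, (∀ c, a * c * b = 0) → a = 0 ∨ b = 0)
    {z : A} (hz : z ≠ 0) (hzz : ∀ a, ∃ c : K, z * a * z = c • z) :
    ∃ e ∈ 𝒜 0, e ≠ 0 ∧ e * e = e ∧ ∀ a, ∃ c : K, e * a * e = c • e := by
  obtain ⟨k, w, hwk, hw, hww⟩ := exists_homogeneous_mul_mul_eq_smul 𝒜 hz hzz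
  obtain ⟨a, ha⟩ : ∃ a, w * a * w ≠ 0 := by
    by_contra! h
    exact hw ((hprime w w h).elim id id)
  obtain ⟨c, hc⟩ := hww a
  have hc0 : c ≠ 0 := by
    rintro rfl
    exact ha (by rw [hc, zero_smul])
  set y : A := (DirectSum.decompose 𝒜 (c⁻¹ • a) (-k) : A) with hy
  have hyk : y ∈ 𝒜 (-k) := SetLike.coe_mem _
  have hwyw : w * y * w = w := by
    have h1 : w * (c⁻¹ • a) * w = w := by
      rw [mul_smul_comm, smul_mul_assoc, hc, smul_smul, inv_mul_cancel₀ hc0, one_smul]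
    have h2 := DirectSum.coe_decompose_mul_add_of_right_mem 𝒜 (i := k + -k) (j := k)
      (a := w * (c⁻¹ • a)) hwk
    rw [h1, DirectSum.coe_decompose_mul_add_of_left_mem 𝒜 hwk, ← hy, add_neg_cancel, zero_add,
      DirectSum.decompose_of_mem_same 𝒜 hwk] at h2
    exact h2.symm
  refine ⟨w * y, ?_, ?_, ?_, fun b => ?_⟩
  · simpa using SetLike.mul_mem_graded hwk hyk
  · intro h
    rw [h, zero_mul] at hwyw
    exact hw hwyw.symm
  · rw [← mul_assoc, hwyw]
  · obtain ⟨t, ht⟩ := hww (y * b)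
    refine ⟨t, ?_⟩
    rw [← mul_assoc, mul_assoc w y b, ht, smul_mul_assoc]

end Homogeneous

section Corner

variable (K : Type*) {A : Type*} [Field K] [Ring A] [Algebra K A]

/-- The elements fixed by left multiplication by `e`; for `e` idempotent, the right ideal `e A`. -/
def leftFixed (e : A) : Submodule K A where
  carrier := {x | e * x = x}
  add_mem' := fun {x y} (hx : e * x = x) (hy : e * y = y) =>
    show e * (x + y) = x + y by rw [mul_add, hx, hy]
  zero_mem' := mul_zero e
  smul_mem' := fun c x (hx : e * x = x) => show e * (c • x) = c • x by rw [mul_smul_comm, hx]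

variable {K} {e : A}

theorem mul_coe_leftFixed (x : leftFixed K e) : e * (x : A) = x := x.2

theorem mul_mem_leftFixed (x : leftFixed K e) (a : A) : (x : A) * a ∈ leftFixed K e :=
  show e * (x * a) = x * a by rw [← mul_assoc, mul_coe_leftFixed]

theorem mul_mem_leftFixed_of_idem (he : e * e = e) (a : A) : e * a ∈ leftFixed K e :=
  show e * (e * a) = e * a by rw [← mul_assoc, he]

variable (K e) in
/-- Right multiplication on the right ideal `leftFixed K e`. -/
def rightMul : A →ₗ[K] Module.End K (leftFixed K e) :=
  LinearMap.mk₂ K (fun a x => ⟨x * a, mul_mem_leftFixed x a⟩)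
    (fun _ _ _ => Subtype.ext (mul_add _ _ _)) (fun _ _ _ => Subtype.ext (mul_smul_comm _ _ _))
    (fun _ _ _ => Subtype.ext (add_mul _ _ _)) (fun _ _ _ => Subtype.ext (smul_mul_assoc _ _ _))

@[simp]
theorem coe_rightMul_apply (a : A) (x : leftFixed K e) : (rightMul K e a x : A) = x * a := rfl

theorem eq_zero_of_forall_leftFixed_mul
    (hprime : ∀ a b : A, (∀ c, a * c * b = 0) → a = 0 ∨ b = 0) (he0 : e ≠ 0) (he : e * e = e)
    {a : A} (h : ∀ x : leftFixed K e, (x : A) * a = 0) : a = 0 :=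
  (hprime e a fun c => h ⟨e * c, mul_mem_leftFixed_of_idem he c⟩).resolve_left he0

/-- If `e A e = K e` in a finite-dimensional prime algebra, right multiplication identifies `A` with
the endomorphisms of `e A`. -/
theorem rightMul_bijective [FiniteDimensional K A]
    (hprime : ∀ a b : A, (∀ c, a * c * b = 0) → a = 0 ∨ b = 0) (he0 : e ≠ 0) (he : e * e = e)
    (hee : ∀ a, ∃ c : K, e * a * e = c • e) : Function.Bijective (rightMul K e) := by
  refine ⟨(injective_iff_map_eq_zero _).mpr fun a ha =>
    eq_zero_of_forall_leftFixed_mul (K := K) hprime he0 he fun x => ?_, fun f => ?_⟩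
  · rw [← coe_rightMul_apply, ha]
    rfl
  obtain ⟨l, hl⟩ : ∃ l : Module.Dual K A, l e = 1 := Module.Projective.exists_dual_eq_one K he0
  let R : Submodule K A := LinearMap.eqLocus (LinearMap.mulRight K e) LinearMap.id
  have hR : ∀ b : R, (b : A) * e = b := fun b => b.2
  have hxb : ∀ (x : leftFixed K e) (b : R), (x : A) * b = l (x * b) • e := by
    intro x b
    obtain ⟨c, hc⟩ := hee (x * b)
    rw [← mul_assoc, mul_coe_leftFixed, mul_assoc, hR] at hc
    rw [hc, map_smul, hl, smul_eq_mul, mul_one]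
  let p : leftFixed K e →ₗ[K] R →ₗ[K] K :=
    ((LinearMap.mul K A).compr₂ l).domRestrict₁₂ (leftFixed K e) R
  have hp : ∀ x b, p x b = l ((x : A) * b) := fun _ _ => rfl
  have hperf : p.IsPerfPair := by
    refine .of_injective ((injective_iff_map_eq_zero _).mpr fun x hx => ?_)
      ((injective_iff_map_eq_zero _).mpr fun b hb => ?_)
    · refine Subtype.ext ((hprime x e fun c => ?_).resolve_right he0)
      have hce : c * e ∈ R := show c * e * e = c * e by rw [mul_assoc, he]
      have h1 := hxb x ⟨c * e, hce⟩
      rw [← hp, hx, LinearMap.zero_apply, zero_smul] at h1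
      rw [mul_assoc, h1]
    · refine Subtype.ext (eq_zero_of_forall_leftFixed_mul (K := K) hprime he0 he fun x => ?_)
      rw [hxb, ← hp, ← LinearMap.flip_apply, hb, LinearMap.zero_apply, zero_smul]
  let B := Module.finBasis K (leftFixed K e)
  choose b hb using fun i => hperf.bijective_right.2 (B.coord i)
  refine ⟨∑ i, (b i : A) * f (B i), B.ext fun j => Subtype.ext ?_⟩
  rw [coe_rightMul_apply, Finset.mul_sum, Finset.sum_eq_single j]
  · have h1 : l ((B j : A) * b j) = 1 := by
      rw [← hp, ← LinearMap.flip_apply, hb]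
      simp
    rw [← mul_assoc, hxb, h1, one_smul, mul_coe_leftFixed]
  · intro i _ hij
    have h1 : l ((B j : A) * b i) = 0 := by
      rw [← hp, ← LinearMap.flip_apply, hb]
      simp [hij.symm]
    rw [← mul_assoc, hxb, h1, zero_smul, zero_mul]
  · simp

end Corner

section SignOp

variable {K C : Type} [Field K] [AddCommGroup C] [Module K C] (𝒞 : ℤ → Submodule K C)
  [DirectSum.Decomposition 𝒞]

theorem signOp_apply_of_mem {k : ℤ} {x : C} (hx : x ∈ 𝒞 k) :
    signOp K 𝒞 x = (-1 : K) ^ k • x := by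
  rw [signOp, LinearMap.comp_apply, LinearEquiv.coe_coe, DirectSum.decomposeLinearEquiv_apply,
    DirectSum.decompose_of_mem 𝒞 hx, ← DirectSum.lof_eq_of K, DirectSum.toModule_lof,
    neg_one_pow_natAbs_eq_zpow]
  rfl

theorem signOp_pow_apply_of_mem {k : ℤ} {x : C} (hx : x ∈ 𝒞 k) (m : ℤ) :
    (signOp K 𝒞 ^ m.natAbs) x = (-1 : K) ^ (m * k) • x := by
  rw [← neg_one_pow_natAbs_mul_natAbs, mul_comm m.natAbs, pow_mul, neg_one_pow_natAbs_eq_zpow]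
  induction m.natAbs with
  | zero => simp
  | succ j ih =>
    rw [pow_succ', Module.End.mul_apply, ih, map_smul, signOp_apply_of_mem 𝒞 hx, smul_smul,
      pow_succ]

end SignOp

section GradedCorner

variable {K A : Type} [Field K] [Ring A] [Algebra K A] (𝒜 : ℤ → Submodule K A)

variable (K) in
/-- The grading induced on the right ideal `leftFixed K e`. -/
def leftFixedGrading (e : A) (n : ℤ) : Submodule K (leftFixed K e) :=
  (𝒜 n).comap (leftFixed K e).subtype

variable {𝒜} {e : A}

theorem mem_leftFixedGrading {n : ℤ} {x : leftFixed K e} :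
    x ∈ leftFixedGrading K 𝒜 e n ↔ (x : A) ∈ 𝒜 n := Iff.rfl

theorem leftFixed_ext [DirectSum.Decomposition (leftFixedGrading K 𝒜 e)]
    {f g : Module.End K (leftFixed K e)}
    (h : ∀ (k : ℤ) (x : leftFixed K e), (x : A) ∈ 𝒜 k → (f x : A) = g x) : f = g :=
  LinearMap.ext fun x => by
    induction x using DirectSum.Decomposition.inductionOn (leftFixedGrading K 𝒜 e) with
    | zero => simp
    | homogeneous x => exact Subtype.ext (h _ _ x.2)
    | add x y hx hy => rw [map_add, map_add, hx, hy]

variable [GradedAlgebra 𝒜]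

theorem isInternal_leftFixedGrading (he : e ∈ 𝒜 0) :
    DirectSum.IsInternal (leftFixedGrading K 𝒜 e) := by
  classical
  rw [DirectSum.isInternal_submodule_iff_iSupIndep_and_iSup_eq_top]
  constructor
  · have h := (DirectSum.Decomposition.isInternal 𝒜).submodule_iSupIndep
    rw [iSupIndep_def] at h ⊢
    intro i
    rw [Submodule.disjoint_def]
    intro x hx hx'
    refine Subtype.ext (Submodule.disjoint_def.mp (h i) x hx ?_)
    have h1 := Submodule.mem_map_of_mem (f := (leftFixed K e).subtype) hx'
    simp only [Submodule.map_iSup] at h1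
    exact iSup₂_mono (fun j _ => Submodule.map_comap_le _ _) h1
  · refine eq_top_iff.mpr fun x _ => ?_
    have hmem : ∀ i, (DirectSum.decompose 𝒜 (x : A) i : A) ∈ leftFixed K e := fun i => by
      have h := DirectSum.coe_decompose_mul_add_of_left_mem 𝒜 (j := i) (b := (x : A)) he
      rw [mul_coe_leftFixed, zero_add] at h
      exact h.symm
    have hx : x = ∑ i ∈ (DirectSum.decompose 𝒜 (x : A)).support,
        (⟨DirectSum.decompose 𝒜 (x : A) i, hmem i⟩ : leftFixed K e) := by
      refine Subtype.ext ?_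
      rw [AddSubmonoidClass.coe_finsetSum]
      exact (DirectSum.sum_support_decompose 𝒜 (x : A)).symm
    rw [hx]
    exact Submodule.sum_mem _ fun i _ =>
      Submodule.mem_iSup_of_mem i (SetLike.coe_mem (DirectSum.decompose 𝒜 (x : A) i))

variable [DirectSum.Decomposition (leftFixedGrading K 𝒜 e)]

variable (K 𝒜 e) in
/-- Right multiplication on `leftFixed K e` with its Koszul sign: a homogeneous `a` sends a
homogeneous `x` to `(-1)^{|a||x|} x a`. -/
noncomputable def koszulRightMul : A →ₗ[K] Module.End K (leftFixed K e) :=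
  (DirectSum.toModule K ℤ _ fun m =>
    LinearMap.mulRight K (signOp K (leftFixedGrading K 𝒜 e) ^ m.natAbs) ∘ₗ
      rightMul K e ∘ₗ (𝒜 m).subtype) ∘ₗ (DirectSum.decomposeLinearEquiv 𝒜).toLinearMap

theorem koszulRightMul_apply_of_mem {m : ℤ} {a : A} (ha : a ∈ 𝒜 m) :
    koszulRightMul K 𝒜 e a =
      rightMul K e a * signOp K (leftFixedGrading K 𝒜 e) ^ m.natAbs := by
  rw [koszulRightMul, LinearMap.comp_apply, LinearEquiv.coe_coe,
    DirectSum.decomposeLinearEquiv_apply, DirectSum.decompose_of_mem 𝒜 ha,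
    ← DirectSum.lof_eq_of K, DirectSum.toModule_lof]
  rfl

theorem coe_koszulRightMul_apply_of_mem {m k : ℤ} {a : A} (ha : a ∈ 𝒜 m) {x : leftFixed K e}
    (hx : (x : A) ∈ 𝒜 k) :
    (koszulRightMul K 𝒜 e a x : A) = (-1 : K) ^ (m * k) • ((x : A) * a) := by
  rw [koszulRightMul_apply_of_mem ha, Module.End.mul_apply,
    signOp_pow_apply_of_mem _ (mem_leftFixedGrading.mpr hx), map_smul, Submodule.coe_smul,
    coe_rightMul_apply]

theorem koszulRightMul_mem_endGrading {m : ℤ} {a : A} (ha : a ∈ 𝒜 m) :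
    koszulRightMul K 𝒜 e a ∈ endGrading K (leftFixedGrading K 𝒜 e) m := fun k x hx => by
  rw [mem_leftFixedGrading, coe_koszulRightMul_apply_of_mem ha hx]
  exact Submodule.smul_mem _ _ (SetLike.mul_mem_graded hx ha)

theorem coe_decompose_koszulRightMul_apply {k : ℤ} (a : A) {x : leftFixed K e}
    (hx : (x : A) ∈ 𝒜 k) (m : ℤ) :
    (DirectSum.decompose 𝒜 (koszulRightMul K 𝒜 e a x : A) (k + m) : A) =
      (-1 : K) ^ (m * k) • ((x : A) * DirectSum.decompose 𝒜 a m) := by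
  induction a using DirectSum.Decomposition.inductionOn 𝒜 with
  | zero => simp
  | add a b ha hb =>
    rw [map_add, LinearMap.add_apply, Submodule.coe_add, DirectSum.decompose_add,
      DirectSum.decompose_add, DirectSum.add_apply, DirectSum.add_apply, Submodule.coe_add,
      Submodule.coe_add, ha, hb, mul_add, smul_add]
  | @homogeneous j a =>
    rw [coe_koszulRightMul_apply_of_mem a.2 hx, DirectSum.decompose_smul, DirectSum.smul_apply,
      Submodule.coe_smul, DirectSum.coe_decompose_mul_add_of_left_mem 𝒜 hx]
    by_cases h : j = m
    · subst h; rfl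
    · rw [DirectSum.decompose_of_mem_ne 𝒜 a.2 h, mul_zero, smul_zero, smul_zero]

theorem mem_of_koszulRightMul_mem_endGrading
    (hprime : ∀ a b : A, (∀ c, a * c * b = 0) → a = 0 ∨ b = 0) (he0 : e ≠ 0) (he : e * e = e)
    {n : ℤ} {a : A}
    (ha : koszulRightMul K 𝒜 e a ∈ endGrading K (leftFixedGrading K 𝒜 e) n) : a ∈ 𝒜 n := by
  classical
  have hcomp : ∀ m, m ≠ n → (DirectSum.decompose 𝒜 a m : A) = 0 := fun m hm => by
    refine eq_zero_of_forall_leftFixed_mul (K := K) hprime he0 he fun x => ?_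
    induction x using DirectSum.Decomposition.inductionOn (leftFixedGrading K 𝒜 e) with
    | zero => simp
    | add x y hx hy => rw [Submodule.coe_add, add_mul, hx, hy, add_zero]
    | @homogeneous k x =>
      have h := coe_decompose_koszulRightMul_apply a (mem_leftFixedGrading.mp x.2) m
      have hxa : (koszulRightMul K 𝒜 e a x : A) ∈ 𝒜 (k + n) := ha k x x.2
      rw [DirectSum.decompose_of_mem_ne 𝒜 hxa (by omega)] at h
      exact (smul_eq_zero.mp h.symm).resolve_left (zpow_ne_zero _ (by simp))
  rw [← DirectSum.sum_support_decompose 𝒜 a]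
  refine Submodule.sum_mem _ fun m _ => ?_
  by_cases hm : m = n
  · exact hm ▸ SetLike.coe_mem _
  · rw [hcomp m hm]
    exact zero_mem _

theorem koszulRightMul_injective
    (hprime : ∀ a b : A, (∀ c, a * c * b = 0) → a = 0 ∨ b = 0) (he0 : e ≠ 0) (he : e * e = e) :
    Function.Injective (koszulRightMul K 𝒜 e) := by
  refine (injective_iff_map_eq_zero _).mpr fun a ha => by_contra fun h => ?_
  have hmem : ∀ n, a ∈ 𝒜 n := fun n =>
    mem_of_koszulRightMul_mem_endGrading hprime he0 he (ha ▸ zero_mem _)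
  exact zero_ne_one (DirectSum.degree_eq_of_mem_mem 𝒜 (hmem 0) (hmem 1) h)

theorem koszulRightMul_bijective [FiniteDimensional K A]
    (hprime : ∀ a b : A, (∀ c, a * c * b = 0) → a = 0 ∨ b = 0) (he0 : e ≠ 0) (he : e * e = e)
    (hee : ∀ a, ∃ c : K, e * a * e = c • e) : Function.Bijective (koszulRightMul K 𝒜 e) := by
  have hinj := koszulRightMul_injective (K := K) (𝒜 := 𝒜) hprime he0 he
  refine ⟨hinj, fun f => ?_⟩
  let r := LinearEquiv.ofBijective (rightMul K e) (rightMul_bijective hprime he0 he hee)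
  have hsurj : Function.Surjective (r.symm.toLinearMap ∘ₗ koszulRightMul K 𝒜 e) :=
    LinearMap.injective_iff_surjective.mp (r.symm.injective.comp hinj)
  obtain ⟨a, ha⟩ := hsurj (r.symm f)
  exact ⟨a, r.symm.injective ha⟩

theorem map_koszulRightMul
    (hprime : ∀ a b : A, (∀ c, a * c * b = 0) → a = 0 ∨ b = 0) (he0 : e ≠ 0) (he : e * e = e)
    (hsurj : Function.Surjective (koszulRightMul K 𝒜 e)) (n : ℤ) :
    (𝒜 n).map (koszulRightMul K 𝒜 e) = endGrading K (leftFixedGrading K 𝒜 e) n := by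
  refine le_antisymm (Submodule.map_le_iff_le_comap.mpr fun a ha =>
    koszulRightMul_mem_endGrading ha) fun f hf => ?_
  obtain ⟨a, rfl⟩ := hsurj f
  exact ⟨a, mem_of_koszulRightMul_mem_endGrading hprime he0 he hf, rfl⟩

theorem koszulRightMul_one : koszulRightMul K 𝒜 e 1 = 1 := by
  rw [koszulRightMul_apply_of_mem SetLike.GradedOne.one_mem, Int.natAbs_zero, pow_zero, mul_one]
  exact LinearMap.ext fun x => Subtype.ext (mul_one _)

theorem koszulRightMul_mul {m n : ℤ} {a b : A} (ha : a ∈ 𝒜 m) (hb : b ∈ 𝒜 n) :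
    koszulRightMul K 𝒜 e (a * b) =
      (-1 : K) ^ (m * n) • (koszulRightMul K 𝒜 e b * koszulRightMul K 𝒜 e a) := by
  refine leftFixed_ext (𝒜 := 𝒜) fun k x hx => ?_
  have hxa : (koszulRightMul K 𝒜 e a x : A) ∈ 𝒜 (k + m) := koszulRightMul_mem_endGrading ha k x hx
  rw [coe_koszulRightMul_apply_of_mem (SetLike.mul_mem_graded ha hb) hx, LinearMap.smul_apply,
    Submodule.coe_smul, Module.End.mul_apply, coe_koszulRightMul_apply_of_mem hb hxa,
    coe_koszulRightMul_apply_of_mem ha hx, smul_mul_assoc, smul_smul, smul_smul, mul_assoc]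
  have h1 : (-1 : K) ≠ 0 := by simp
  rw [← zpow_add₀ h1, ← zpow_add₀ h1,
    show m * n + (n * (k + m) + m * k) = (m + n) * k + 2 * (m * n) by ring, zpow_add₀ h1,
    (even_two_mul (m * n)).neg_one_zpow, mul_one, mul_assoc]

end GradedCorner

theorem gradedMonoid_endGrading {K C : Type} [Field K] [AddCommGroup C] [Module K C]
    (𝒞 : ℤ → Submodule K C) : SetLike.GradedMonoid (endGrading K 𝒞) where
  one_mem k x hx := by simpa using hx
  mul_mem i j f g hf hg k x hx := by
    rw [add_comm i j, ← add_assoc]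
    exact hf _ _ (hg k x hx)

theorem DirectSum.IsInternal.map_linearEquiv {K M N ι : Type*} [Field K] [AddCommGroup M]
    [Module K M] [AddCommGroup N] [Module K N] [DecidableEq ι] {ℳ : ι → Submodule K M}
    (h : DirectSum.IsInternal ℳ) (f : M ≃ₗ[K] N) :
    DirectSum.IsInternal fun i => (ℳ i).map f.toLinearMap := by
  rw [DirectSum.isInternal_submodule_iff_iSupIndep_and_iSup_eq_top] at h ⊢
  refine ⟨f.toLinearMap.iSupIndep_map f.injective h.1, ?_⟩
  rw [← Submodule.map_iSup, h.2, Submodule.map_top, LinearEquiv.range]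

section Differential

variable {K A : Type} [Field K] [Ring A] [Algebra K A] {𝒜 : ℤ → Submodule K A} {d : A →ₗ[K] A}
  {e : A}

/-- The map `x ↦ e * d x` on the right ideal `leftFixed K e`. -/
def cornerDiff (d : A →ₗ[K] A) (he : e * e = e) : leftFixed K e →ₗ[K] leftFixed K e :=
  (LinearMap.mulLeft K e ∘ₗ d ∘ₗ (leftFixed K e).subtype).codRestrict _ fun _ =>
    mul_mem_leftFixed_of_idem he _

@[simp]
theorem coe_cornerDiff_apply (he : e * e = e) (x : leftFixed K e) :
    (cornerDiff d he x : A) = e * d x := rfl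

variable [GradedAlgebra 𝒜]

theorem IsDGAlgebra.leibniz_of_mem_zero (hA : IsDGAlgebra 𝒜 d) (he : e ∈ 𝒜 0) (b : A) :
    d (e * b) = d e * b + e * d b := by
  induction b using DirectSum.Decomposition.inductionOn 𝒜 with
  | zero => simp
  | homogeneous b => simpa using hA.leibniz 0 _ e he b b.2
  | add a b ha hb =>
    rw [mul_add, map_add, ha, hb, map_add]
    noncomm_ring

theorem isComplex_cornerDiff (hA : IsDGAlgebra 𝒜 d) (he0 : e ∈ 𝒜 0) (he : e * e = e)
    (hee : ∀ a, ∃ c : K, e * a * e = c • e) :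
    IsComplex (leftFixedGrading K 𝒜 e) (cornerDiff d he) where
  map_mem n x hx := by
    rw [mem_leftFixedGrading, coe_cornerDiff_apply]
    simpa using SetLike.mul_mem_graded he0 (hA.map_mem n _ hx)
  sq x := by
    have hde : d e = d e * e + e * d e := by
      conv_lhs => rw [← he]
      exact hA.leibniz_of_mem_zero he0 e
    have hede : e * d e * e = 0 := by
      have h := congrArg (e * ·) hde
      simp only [mul_add, ← mul_assoc, he] at h
      exact left_eq_add.mp (h.trans (add_comm _ _))
    have hdx : d x = d e * x + e * d x := by
      conv_lhs => rw [← mul_coe_leftFixed x]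
      exact hA.leibniz_of_mem_zero he0 _
    have hcurv : e * (d e * d e) * e = 0 := by
      have hdeg : e * (d e * d e) * e ∈ 𝒜 2 := by
        have h1 := hA.map_mem 0 e he0
        simpa using SetLike.mul_mem_graded
          (SetLike.mul_mem_graded he0 (SetLike.mul_mem_graded h1 h1)) he0
      obtain ⟨c, hc⟩ := hee (d e * d e)
      by_contra h
      have hdeg' : e * (d e * d e) * e ∈ 𝒜 0 := hc ▸ Submodule.smul_mem _ c he0
      exact absurd (DirectSum.degree_eq_of_mem_mem 𝒜 hdeg hdeg' h) (by norm_num)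
    refine Subtype.ext ?_
    rw [coe_cornerDiff_apply, coe_cornerDiff_apply, hA.leibniz_of_mem_zero he0, hA.sq, mul_zero,
      add_zero, hdx, Submodule.coe_zero]
    calc e * (d e * (d e * x + e * d x))
        = e * (d e * d e) * x + e * d e * e * d x := by noncomm_ring
      _ = e * (d e * d e) * e * x + e * d e * e * d x := by
        rw [mul_assoc _ e (x : A), mul_coe_leftFixed]
      _ = 0 := by rw [hcurv, hede, zero_mul, zero_mul, add_zero]

theorem koszulRightMul_diff [DirectSum.Decomposition (leftFixedGrading K 𝒜 e)]
    (hA : IsDGAlgebra 𝒜 d) (he0 : e ∈ 𝒜 0) (he : e * e = e) (a : A) :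
    koszulRightMul K 𝒜 e (d a) =
      endDiff K (leftFixedGrading K 𝒜 e) (cornerDiff d he) (koszulRightMul K 𝒜 e a) := by
  induction a using DirectSum.Decomposition.inductionOn 𝒜 with
  | zero => simp
  | add a b ha hb => simp only [map_add, ha, hb]
  | @homogeneous m a =>
    have h1 : (-1 : K) ≠ 0 := by simp
    refine leftFixed_ext (𝒜 := 𝒜) fun k x hx => ?_
    set y := cornerDiff d he x with hy
    have hyk : (y : A) ∈ 𝒜 (k + 1) := by
      rw [hy, coe_cornerDiff_apply]
      simpa using SetLike.mul_mem_graded he0 (hA.map_mem k _ hx)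
    have hya := koszulRightMul_mem_endGrading (e := e) a.2 (k + 1) y hyk
    have hsign : (-1 : K) ^ (k + 1 + m) * ((-1 : K) ^ (k + 1) * (-1 : K) ^ (m * (k + 1))) =
        (-1 : K) ^ (m * k) := by
      rw [← zpow_add₀ h1, ← zpow_add₀ h1,
        show k + 1 + m + (k + 1 + m * (k + 1)) = m * k + 2 * (k + 1 + m) by ring,
        zpow_add₀ h1, (even_two_mul _).neg_one_zpow, mul_one]
    change _ = ((cornerDiff d he (koszulRightMul K 𝒜 e a x) - signOp K (leftFixedGrading K 𝒜 e)
      (koszulRightMul K 𝒜 e a (signOp K (leftFixedGrading K 𝒜 e) y)) : leftFixed K e) : A)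
    rw [signOp_apply_of_mem _ (mem_leftFixedGrading.mpr hyk), map_smul, map_smul,
      signOp_apply_of_mem _ hya, Submodule.coe_sub, Submodule.coe_smul, Submodule.coe_smul,
      coe_koszulRightMul_apply_of_mem a.2 hyk,
      coe_koszulRightMul_apply_of_mem (hA.map_mem m _ a.2) hx,
      coe_cornerDiff_apply, coe_koszulRightMul_apply_of_mem a.2 hx, map_smul,
      hA.leibniz k m x hx a a.2, hy, coe_cornerDiff_apply, smul_smul, smul_smul,
      mul_comm ((-1 : K) ^ (k + 1)), mul_assoc ((-1 : K) ^ (k + 1 + m)), hsign, mul_smul_comm,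
      mul_add, mul_smul_comm, smul_add, ← mul_assoc, ← mul_assoc, mul_coe_leftFixed,
      add_sub_cancel_left, neg_one_pow_natAbs_eq_zpow, smul_smul, ← zpow_add₀ h1, add_mul, one_mul]

end Differential

/-- Let `(A, 𝒜, d)` be a finite-dimensional dg `K`-algebra which is
split simple as a `K`-algebra (isomorphic to a full matrix algebra over `K`).  Then there
is a bounded complex `L` of finite-dimensional `K`-vector spaces such that
`A ≅ End•_K(L)ᵒᵖ` as differential graded `K`-algebras; the witnessing map `σ` is a
`K`-linear bijection which is unital, degree-preserving, commutes with the differentials,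
and is multiplicative into the Koszul-opposite multiplication of `End•_K(L)`. -/
theorem split_simple_dg_iso_end_op (K A : Type) [Field K] [Ring A] [Algebra K A]
    [FiniteDimensional K A]
    (𝒜 : ℤ → Submodule K A) [GradedAlgebra 𝒜] (d : A →ₗ[K] A) (hA : IsDGAlgebra 𝒜 d)
    (hsplit : ∃ n : ℕ, 0 < n ∧ Nonempty (A ≃ₐ[K] Matrix (Fin n) (Fin n) K)) :
    ∃ L : FinComplex K, ∃ σ : A ≃ₗ[K] Module.End K L.carrier,
      σ 1 = 1 ∧
      (∀ n : ℤ, (𝒜 n).map σ.toLinearMap = endGrading K L.grading n) ∧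
      (∀ a : A, σ (d a) = endDiff K L.grading L.diff (σ a)) ∧
      (∀ m n : ℤ, ∀ a ∈ 𝒜 m, ∀ b ∈ 𝒜 n,
        σ (a * b) = ((-1 : K) ^ (m.natAbs * n.natAbs)) • (σ b * σ a)) := by
  
  obtain ⟨n, hn, ⟨φ⟩⟩ := hsplit
  have hprime : ∀ a b : A, (∀ c, a * c * b = 0) → a = 0 ∨ b = 0 := fun a b h => by
    have h' := Matrix.eq_zero_or_eq_zero_of_forall_mul_mul_eq_zero (M := φ a) (N := φ b) fun C => by
      rw [← φ.apply_symm_apply C, ← map_mul, ← map_mul, h, map_zero]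
    simpa using h'
  let i : Fin n := ⟨0, hn⟩
  have hz : φ.symm (Matrix.single i i 1) ≠ 0 := by
    rw [Ne, EmbeddingLike.map_eq_zero_iff]
    intro h
    simpa using congrFun (congrFun h i) i
  obtain ⟨e, he0, hne, he, hee⟩ := exists_idempotent_degree_zero 𝒜 hprime hz fun a =>
    ⟨φ a i i, φ.injective (by
      rw [map_mul, map_mul, map_smul, φ.apply_symm_apply, Matrix.single_mul_mul_single_eq_smul])⟩
  let : DirectSum.Decomposition (leftFixedGrading K 𝒜 e) :=
    (isInternal_leftFixedGrading he0).chooseDecomposition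
  let σ : A ≃ₗ[K] Module.End K (leftFixed K e) :=
    LinearEquiv.ofBijective (koszulRightMul K 𝒜 e) (koszulRightMul_bijective hprime hne he hee)
  have hmap : ∀ n, (𝒜 n).map σ.toLinearMap = endGrading K (leftFixedGrading K 𝒜 e) n :=
    map_koszulRightMul hprime hne he σ.surjective
  have hint : DirectSum.IsInternal (endGrading K (leftFixedGrading K 𝒜 e)) := by
    have h := (DirectSum.Decomposition.isInternal 𝒜).map_linearEquiv
      (N := Module.End K (leftFixed K e)) σ
    simpa only [hmap] using h
  let : GradedAlgebra (endGrading K (leftFixedGrading K 𝒜 e)) :=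
    { gradedMonoid_endGrading _, hint.chooseDecomposition with }
  have hone : σ 1 = 1 := koszulRightMul_one
  have hdiff : ∀ a, σ (d a) = endDiff K (leftFixedGrading K 𝒜 e) (cornerDiff d he) (σ a) :=
    koszulRightMul_diff hA he0 he
  have hmul : ∀ m n : ℤ, ∀ a ∈ 𝒜 m, ∀ b ∈ 𝒜 n,
      σ (a * b) = ((-1 : K) ^ (m.natAbs * n.natAbs)) • (σ b * σ a) := fun m n a ha b hb => by
    rw [neg_one_pow_natAbs_mul_natAbs]
    exact koszulRightMul_mul ha hb
  exact ⟨⟨leftFixed K e, leftFixedGrading K 𝒜 e, cornerDiff d he,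
    isComplex_cornerDiff hA he0 he hee⟩, σ, hone, hmap, hdiff, hmul⟩
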